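/- arXiv:1811.12929 — 5 statements merged into one kernel-verified Lean document; each statement's English description precedes it below -/
import Mathlib

section
/- Let B be a reward respecting partition of a finite MDP M = ⟨S,A,Φ,P,R⟩ and let (s1,a1),(s2,a2) ∈ Φ be such that T(s1,a1,[s']_{B|S}) ≠ T(s2,a2,[s']_{B|S}) for some s' ∈ S. Then for every partition B' of Φ that is a reward respecting SSP partition and is a refinement of B, the pairs (s1,a1) and (s2,a2) do not lie in the same block of B'. -/
open Classical in
/-- Block transition probability `T(s,a,C) = Σ_{s'' ∈ C} P(s,a,s'')`. -/
noncomputable def blockT {S A : Type} [Fintype S] (P : S → A → S → ℝ)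
    (s : S) (a : A) (C : Set S) : ℝ :=
  ∑ s' : S, if s' ∈ C then P s a s' else 0

/-- `B` is a partition of the set `Φ`. -/
def IsPartition {X : Type} (Φ : Set X) (B : Set (Set X)) : Prop :=
  (∀ b ∈ B, b.Nonempty) ∧ (⋃₀ B = Φ) ∧
    (∀ b ∈ B, ∀ c ∈ B, b ≠ c → Disjoint b c)

/-- `p` and `q` lie in the same block of `B`. -/
def SameBlock {X : Type} (B : Set (Set X)) (p q : X) : Prop :=
  ∃ b ∈ B, p ∈ b ∧ q ∈ b

/-- `B(s)`: the set of blocks of `B` containing a pair whose state component is `s`. -/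
def stateBlocks {S A : Type} (B : Set (Set (S × A))) (s : S) : Set (Set (S × A)) :=
  {b ∈ B | ∃ a, (s, a) ∈ b}

/-- The block `[s]_{B|S}` of the projection `B|S` containing the state `s`. -/
def projBlock {S A : Type} (B : Set (Set (S × A))) (s : S) : Set S :=
  {s' | stateBlocks B s' = stateBlocks B s}

/-- The projection `B|S` of a state-action partition `B` onto the state space. -/
def proj {S A : Type} (B : Set (Set (S × A))) : Set (Set S) :=
  Set.range (projBlock B)

/-- `B'` is a refinement of `B`: every block of `B'` is a subset of some block of `B`. -/
def Refines {X : Type} (B' B : Set (Set X)) : Prop :=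
  ∀ b' ∈ B', ∃ b ∈ B, b' ⊆ b

/-- `C` is a union of blocks of the partition `B`. -/
def UnionOfBlocks {X : Type} (B : Set (Set X)) (C : Set X) : Prop :=
  ∃ 𝒞 ⊆ B, C = ⋃₀ 𝒞

/-- A partition is reward respecting if state-action pairs in the same block
get the same reward. -/
def RewardRespecting {S A : Type} (R : S → A → ℝ) (B : Set (Set (S × A))) : Prop :=
  ∀ p q : S × A, SameBlock B p q → R p.1 p.2 = R q.1 q.2

/-- Stochastic substitution property. -/
def SSP {S A : Type} [Fintype S] (P : S → A → S → ℝ) (B : Set (Set (S × A))) : Prop :=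
  ∀ p q : S × A, SameBlock B p q →
    ∀ c ∈ proj B, blockT P p.1 p.2 c = blockT P q.1 q.2 c

/-- `Split(b,C,B)`: replace the block `b` of `B` by the nonempty level sets of
`(s,a) ↦ T(s,a,C)` restricted to `b`. -/
def split {S A : Type} [Fintype S] (P : S → A → S → ℝ) (b : Set (S × A)) (C : Set S)
    (B : Set (Set (S × A))) : Set (Set (S × A)) :=
  (B \ {b}) ∪ {d | d.Nonempty ∧ ∃ r : ℝ, d = {p ∈ b | blockT P p.1 p.2 C = r}}

/-- The conditions making `⟨S,A,Φ,P,R⟩` a finite MDP: every state has an admissible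
action, and `P(s,a,·)` is a probability distribution for each admissible `(s,a)`. -/
def IsMDP {S A : Type} [Fintype S] [Fintype A] (Φ : Set (S × A))
    (P : S → A → S → ℝ) : Prop :=
  (∀ s : S, ∃ a : A, (s, a) ∈ Φ) ∧
  (∀ p ∈ Φ, ∀ s' : S, 0 ≤ P p.1 p.2 s' ∧ P p.1 p.2 s' ≤ 1) ∧
  (∀ p ∈ Φ, ∑ s' : S, P p.1 p.2 s' = 1)

/-- The canonical quotient map sending a state to its block of `B|S`. -/
def quotientMap {S A : Type} (B : Set (Set (S × A))) (s : S) : ↥(proj B) :=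
  ⟨projBlock B s, ⟨s, rfl⟩⟩

/-- `⟨f, {g_s}⟩` is an MDP homomorphism. -/
def IsMDPHom {S A S' A' : Type} [Fintype S]
    (Φ : Set (S × A)) (P : S → A → S → ℝ) (R : S → A → ℝ)
    (Φ' : Set (S' × A')) (P' : S' → A' → S' → ℝ) (R' : S' → A' → ℝ)
    (f : S → S') (g : S → A → A') : Prop :=
  Function.Surjective f ∧
  (∀ p ∈ Φ, (f p.1, g p.1 p.2) ∈ Φ') ∧
  (∀ s : S, ∀ a' : A', (f s, a') ∈ Φ' → ∃ a : A, (s, a) ∈ Φ ∧ g s a = a') ∧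
  (∀ p ∈ Φ, R p.1 p.2 = R' (f p.1) (g p.1 p.2)) ∧
  (∀ p ∈ Φ, ∀ s' : S,
    blockT P p.1 p.2 {s'' | f s'' = f s'} = P' (f p.1) (g p.1 p.2) (f s'))

/-- `Q` satisfies the Bellman optimality equation for the MDP `⟨S,A,Φ,P,R⟩`
with discount factor `γ`. -/
noncomputable def IsBellmanSolution {S A : Type} [Fintype S] (Φ : Set (S × A))
    (P : S → A → S → ℝ) (R : S → A → ℝ) (γ : ℝ) (Q : S → A → ℝ) : Prop :=
  ∀ p ∈ Φ, Q p.1 p.2 = R p.1 p.2 +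
    γ * ∑ s' : S, P p.1 p.2 s' * sSup {x : ℝ | ∃ a'' : A, (s', a'') ∈ Φ ∧ x = Q s' a''}

theorem mem_projBlock_self {S A : Type} (B : Set (Set (S × A))) (s : S) :
    s ∈ projBlock B s := rfl

theorem projBlock_eq_iff {S A : Type} (B : Set (Set (S × A))) (s t : S) :
    projBlock B s = projBlock B t ↔ s ∈ projBlock B t := by
  refine ⟨fun h => h ▸ mem_projBlock_self B s, fun h => ?_⟩
  ext u
  have h' : stateBlocks B s = stateBlocks B t := h
  simp only [projBlock, Set.mem_ofPred_eq, h']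

theorem stateBlocks_subset_of_refines {S A : Type} {Φ : Set (S × A)}
    {B B' : Set (Set (S × A))} (hB : IsPartition Φ B) (hB' : IsPartition Φ B')
    (href : Refines B' B) {s t : S} (h : stateBlocks B' s = stateBlocks B' t) :
    stateBlocks B s ⊆ stateBlocks B t := by
  rintro b ⟨hb, a, hab⟩
  have hΦ : (s, a) ∈ ⋃₀ B' := by
    rw [hB'.2.1, ← hB.2.1]
    exact ⟨b, hb, hab⟩
  obtain ⟨b', hb', hab'⟩ := hΦ
  obtain ⟨c, hc, hsub⟩ := href b' hb'
  have hcb : c = b := by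
    by_contra hne
    exact Set.disjoint_left.mp (hB.2.2 c hc b hb hne) (hsub hab') hab
  have hmem : b' ∈ stateBlocks B' t := h ▸ ⟨hb', a, hab'⟩
  obtain ⟨-, a', ha'⟩ := hmem
  exact ⟨hb, a', hcb ▸ hsub ha'⟩

theorem stateBlocks_eq_of_refines {S A : Type} {Φ : Set (S × A)}
    {B B' : Set (Set (S × A))} (hB : IsPartition Φ B) (hB' : IsPartition Φ B')
    (href : Refines B' B) {s t : S} (h : stateBlocks B' s = stateBlocks B' t) :
    stateBlocks B s = stateBlocks B t :=
  (stateBlocks_subset_of_refines hB hB' href h).antisymm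
    (stateBlocks_subset_of_refines hB hB' href h.symm)

open Classical in
/-- The transition probability into a set saturated for `B|S` is a sum over the blocks of `B|S`. -/
theorem blockT_eq_sum_projBlock {S A : Type} [Fintype S] (P : S → A → S → ℝ)
    (B : Set (Set (S × A))) (C : Set S)
    (hC : ∀ s t, s ∈ projBlock B t → (s ∈ C ↔ t ∈ C)) (s : S) (a : A) :
    blockT P s a C =
      ∑ c ∈ Finset.univ.image (projBlock B), if c ⊆ C then blockT P s a c else 0 := by
  unfold blockT
  rw [← Finset.sum_fiberwise_of_maps_to (g := projBlock B)
    (fun x _ => Finset.mem_image_of_mem _ (Finset.mem_univ x))]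
  refine Finset.sum_congr rfl fun c hc => ?_
  obtain ⟨t, -, rfl⟩ := Finset.mem_image.mp hc
  have hsub : projBlock B t ⊆ C ↔ t ∈ C :=
    ⟨fun h => h (mem_projBlock_self B t), fun h u hu => (hC u t hu).mpr h⟩
  simp only [projBlock_eq_iff, hsub, Finset.sum_filter]
  split_ifs with ht
  · refine Finset.sum_congr rfl fun u _ => ?_
    by_cases hu : u ∈ projBlock B t
    · simp [hu, (hC u t hu).mpr ht]
    · simp [hu]
  · refine Finset.sum_eq_zero fun u _ => ?_
    by_cases hu : u ∈ projBlock B t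
    · simp [hu, mt (hC u t hu).mp ht]
    · simp [hu]

/-- An SSP partition equates transition probabilities into sets saturated for its projection. -/
theorem SSP.blockT_eq {S A : Type} [Fintype S] {P : S → A → S → ℝ}
    {B : Set (Set (S × A))} (hSSP : SSP P B) {C : Set S}
    (hC : ∀ s t, s ∈ projBlock B t → (s ∈ C ↔ t ∈ C)) {p q : S × A} (hpq : SameBlock B p q) :
    blockT P p.1 p.2 C = blockT P q.1 q.2 C := by
  classical
  rw [blockT_eq_sum_projBlock P B C hC, blockT_eq_sum_projBlock P B C hC]
  refine Finset.sum_congr rfl fun c hc => ?_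
  obtain ⟨t, -, rfl⟩ := Finset.mem_image.mp hc
  rw [hSSP p q hpq _ ⟨t, rfl⟩]

/-- **Lemma 1.** If `B` is a reward respecting partition of a finite MDP
and `T(s₁,a₁,[s']_{B|S}) ≠ T(s₂,a₂,[s']_{B|S})` for some state `s'`, then `(s₁,a₁)` and
`(s₂,a₂)` are not in the same block of any reward respecting SSP partition refining `B`. -/
theorem stmt0 {S A : Type} [Fintype S] [Fintype A]
    (Φ : Set (S × A)) (P : S → A → S → ℝ) (R : S → A → ℝ)
    (hM : IsMDP Φ P)
    (B : Set (Set (S × A))) (hB : IsPartition Φ B) (hRR : RewardRespecting R B)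
    (p q : S × A) (hp : p ∈ Φ) (hq : q ∈ Φ)
    (hT : ∃ s' : S, blockT P p.1 p.2 (projBlock B s') ≠ blockT P q.1 q.2 (projBlock B s'))
    (B' : Set (Set (S × A))) (hB' : IsPartition Φ B')
    (hRR' : RewardRespecting R B') (hSSP' : SSP P B') (href : Refines B' B) :
    ¬ SameBlock B' p q := by
  intro hpq
  obtain ⟨s', hs'⟩ := hT
  refine hs' (hSSP'.blockT_eq (fun s t hst => ?_) hpq)
  have h := stateBlocks_eq_of_refines hB hB' href hst
  simp only [projBlock, Set.mem_ofPred_eq, h]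
end

section
/- Let B be a reward respecting partition of a finite MDP M = ⟨S,A,Φ,P,R⟩ such that for every block b of B and every block c of the projection B|S, Split(b,c,B) = B. Then B is a reward respecting SSP partition of M. -/
/-- If `B` is a reward respecting partition of a finite MDP such that
`Split(b,c,B) = B` for every block `b` of `B` and every block `c` of the projection `B|S`,
then `B` is a reward respecting SSP partition. -/
theorem stmt5 {S A : Type} [Fintype S] [Fintype A]
    (Φ : Set (S × A)) (P : S → A → S → ℝ) (R : S → A → ℝ)
    (hM : IsMDP Φ P)
    (B : Set (Set (S × A))) (hB : IsPartition Φ B) (hRR : RewardRespecting R B)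
    (hsplit : ∀ b ∈ B, ∀ c ∈ proj B, split P b c B = B) :
    RewardRespecting R B ∧ SSP P B := by
  refine ⟨hRR, ?_⟩
  rintro p q ⟨b, hb, hp, hq⟩ c hc
  have hd : {x ∈ b | blockT P x.1 x.2 c = blockT P p.1 p.2 c} ∈ B := by
    rw [← hsplit b hb c hc]
    exact Or.inr ⟨⟨p, hp, rfl⟩, _, rfl⟩
  have heq : {x ∈ b | blockT P x.1 x.2 c = blockT P p.1 p.2 c} = b := by
    by_contra hne
    exact Set.disjoint_left.mp (hB.2.2 _ hd b hb hne) ⟨hp, rfl⟩ hp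
  exact (heq.ge hq).2.symm
end

section
/- Let B be a reward respecting SSP partition of a finite MDP M = ⟨S,A,Φ,P,R⟩. Then there exist a finite MDP M' = ⟨S',A',Φ',P',R'⟩ whose state set S' is the set of blocks of the projection B|S, together with the quotient map f : S → S', f(s) = [s]_{B|S}, and for each s ∈ S a surjection g_s : A_s → A'_{f(s)}, such that ⟨f,{g_s}⟩ is an MDP homomorphism from M to M'; i.e., the quotient MDP M/B is a homomorphic image of M. -/
theorem quotientMap_eq_iff_mem {S A : Type} (B : Set (Set (S × A))) (s : S) (t : ↥(proj B)) :
    quotientMap B s = t ↔ s ∈ t.1 := by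
  obtain ⟨_, s', rfl⟩ := t
  constructor
  · intro h
    have hs : projBlock B s = projBlock B s' := congrArg Subtype.val h
    exact hs.subset (rfl : s ∈ projBlock B s)
  · intro h
    have hs : stateBlocks B s = stateBlocks B s' := h
    exact Subtype.ext (by simp only [quotientMap, projBlock, hs])

theorem mem_proj_iff_eq {S A : Type} (B : Set (Set (S × A))) (s : S) (t : ↥(proj B)) :
    s ∈ t.1 ↔ t = quotientMap B s := by
  rw [← quotientMap_eq_iff_mem, eq_comm]

theorem sum_blockT_proj {S A : Type} [Fintype S] (P : S → A → S → ℝ)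
    (B : Set (Set (S × A))) [Fintype ↥(proj B)] (s : S) (a : A) :
    ∑ t : ↥(proj B), blockT P s a t.1 = ∑ s' : S, P s a s' := by
  classical
  simp only [blockT]
  rw [Finset.sum_comm]
  refine Finset.sum_congr rfl fun s' _ => ?_
  simp [mem_proj_iff_eq]

theorem blockT_nonneg {S A : Type} [Fintype S] {P : S → A → S → ℝ} {s : S} {a : A}
    (h : ∀ s', 0 ≤ P s a s') (C : Set S) : 0 ≤ blockT P s a C :=
  Finset.sum_nonneg fun s' _ => by split_ifs <;> simp [h s']

theorem blockT_le_sum {S A : Type} [Fintype S] {P : S → A → S → ℝ} {s : S} {a : A}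
    (h : ∀ s', 0 ≤ P s a s') (C : Set S) : blockT P s a C ≤ ∑ s' : S, P s a s' :=
  Finset.sum_le_sum fun s' _ => by split_ifs <;> simp [h s']

/-- Any function constant on the blocks of `B` descends to `B`. -/
theorem exists_blockwise_lift {X Y : Type} [Nonempty Y] (B : Set (Set X)) (F : X → Y)
    (hF : ∀ p q, SameBlock B p q → F p = F q) :
    ∃ G : Set X → Y, ∀ b ∈ B, ∀ p ∈ b, G b = F p := by
  have h : ∀ b : Set X, ∃ y, b ∈ B → ∀ p ∈ b, y = F p := by
    intro b
    by_cases hb : b ∈ B ∧ b.Nonempty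
    · obtain ⟨hb, q, hq⟩ := hb
      exact ⟨F q, fun _ p hp => hF q p ⟨b, hb, hq, hp⟩⟩
    · exact ⟨Classical.arbitrary Y, fun h p hp => absurd ⟨h, p, hp⟩ hb⟩
  choose G hG using h
  exact ⟨G, hG⟩

/-- **Theorem 1.** Given a reward respecting SSP partition `B` of a finite
MDP `M`, there is a finite MDP `M'` whose state set is the set of blocks of `B|S` such
that the quotient map `f(s) = [s]_{B|S}` together with suitable surjections `g_s` is an
MDP homomorphism from `M` to `M'`: the quotient MDP `M/B` is a homomorphic image of `M`. -/
theorem stmt8 {S A : Type} [Fintype S] [Fintype A]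
    (Φ : Set (S × A)) (P : S → A → S → ℝ) (R : S → A → ℝ)
    (hM : IsMDP Φ P)
    (B : Set (Set (S × A))) (hB : IsPartition Φ B)
    (hRR : RewardRespecting R B) (hSSP : SSP P B) :
    ∃ (A' : Type) (_ : Fintype A') (Φ' : Set (↥(proj B) × A'))
      (P' : ↥(proj B) → A' → ↥(proj B) → ℝ) (R' : ↥(proj B) → A' → ℝ)
      (g : S → A → A'),
      -- M' is a finite MDP:
      (∀ t : ↥(proj B), ∃ a' : A', (t, a') ∈ Φ') ∧
      (∀ q ∈ Φ', ∀ t' : ↥(proj B), 0 ≤ P' q.1 q.2 t' ∧ P' q.1 q.2 t' ≤ 1) ∧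
      (∀ q ∈ Φ', ∑ᶠ t' : ↥(proj B), P' q.1 q.2 t' = 1) ∧
      -- the quotient map together with the `g_s` is an MDP homomorphism from M to M':
      IsMDPHom Φ P R Φ' P' R' (quotientMap B) g := by
  classical
  obtain ⟨hact, hP, hsum⟩ := hM
  obtain ⟨-, hcover, hdisj⟩ := hB
  have mem_block : ∀ p ∈ Φ, ∃ b ∈ B, p ∈ b := fun p hp => by
    rwa [← hcover, Set.mem_sUnion] at hp
  have mem_Φ : ∀ b ∈ B, ∀ p ∈ b, p ∈ Φ := fun b hb p hp => hcover ▸ ⟨b, hb, hp⟩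
  have block_unique : ∀ b ∈ B, ∀ c ∈ B, ∀ p, p ∈ b → p ∈ c → b = c :=
    fun b hb c hc p hpb hpc => by
      by_contra hne
      exact Set.disjoint_left.mp (hdisj b hb c hc hne) hpb hpc
  have hblock : ∀ p : S × A, ∃ b, p ∈ Φ → b ∈ B ∧ p ∈ b := fun p => by
    by_cases hp : p ∈ Φ
    · obtain ⟨b, hb⟩ := mem_block p hp
      exact ⟨b, fun _ => hb⟩
    · exact ⟨∅, fun h => absurd h hp⟩
  choose block hblock using hblock
  obtain ⟨T, hT⟩ := exists_blockwise_lift B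
    (fun p (t : ↥(proj B)) => blockT P p.1 p.2 t.1)
    (fun p q hpq => funext fun t => hSSP p q hpq t.1 t.2)
  obtain ⟨r, hr⟩ := exists_blockwise_lift B (fun p => R p.1 p.2) hRR
  refine ⟨Set (S × A), Fintype.ofFinite _,
    {q | q.2 ∈ B ∧ ∃ s a, quotientMap B s = q.1 ∧ (s, a) ∈ q.2},
    fun _ b => T b, fun _ b => r b, fun s a => block (s, a), ?_, ?_, ?_, ?_, ?_, ?_, ?_, ?_⟩
  · rintro ⟨_, s, rfl⟩
    obtain ⟨a, ha⟩ := hact s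
    obtain ⟨b, hb, hab⟩ := mem_block _ ha
    exact ⟨b, hb, s, a, rfl, hab⟩
  · rintro ⟨t, b⟩ ⟨hb, s, a, -, hab⟩ t'
    have hsa := mem_Φ b hb _ hab
    have h0 : ∀ s', 0 ≤ P s a s' := fun s' => (hP _ hsa s').1
    simp only [hT b hb _ hab]
    exact ⟨blockT_nonneg h0 _, (blockT_le_sum h0 _).trans_eq (hsum _ hsa)⟩
  · rintro ⟨t, b⟩ ⟨hb, s, a, -, hab⟩
    have : Fintype ↥(proj B) := Fintype.ofFinite _
    simp only [hT b hb _ hab]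
    rw [finsum_eq_sum_of_fintype, sum_blockT_proj]
    exact hsum _ (mem_Φ b hb _ hab)
  · rintro ⟨_, s, rfl⟩
    exact ⟨s, rfl⟩
  · intro p hp
    exact ⟨(hblock p hp).1, p.1, p.2, rfl, (hblock p hp).2⟩
  · rintro s b ⟨hb, s₀, a₀, hs₀, hab⟩
    have hs : stateBlocks B s = stateBlocks B s₀ :=
      (quotientMap_eq_iff_mem B s (quotientMap B s₀)).mp hs₀.symm
    have hmem : b ∈ stateBlocks B s := hs ▸ ⟨hb, a₀, hab⟩
    obtain ⟨-, a, ha⟩ := hmem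
    have hsa := mem_Φ b hb _ ha
    exact ⟨a, hsa, block_unique _ (hblock _ hsa).1 b hb _ (hblock _ hsa).2 ha⟩
  · intro p hp
    exact (hr _ (hblock p hp).1 p (hblock p hp).2).symm
  · intro p hp s'
    simp only [quotientMap_eq_iff_mem, Set.ofPred_mem_eq]
    exact (congrFun (hT _ (hblock p hp).1 p (hblock p hp).2) (quotientMap B s')).symm
end

section
/- Let ⟨f,{g_s}⟩ be an MDP homomorphism from a finite MDP M = ⟨S,A,Φ,P,R⟩ to a finite MDP M' = ⟨S',A',Φ',P',R'⟩, and let γ ∈ [0,1]. Suppose Q' : Φ' → ℝ satisfies the Bellman optimality equation for M': Q'(t,a') = R'(t,a') + γ Σ_{t'∈S'} P'(t,a',t') max_{a''∈A'_{t'}} Q'(t',a'') for all (t,a') ∈ Φ'. Then the lifted function Q : Φ → ℝ defined by Q(s,a) = Q'(f(s),g_s(a)) satisfies the Bellman optimality equation for M: Q(s,a) = R(s,a) + γ Σ_{s'∈S} P(s,a,s') max_{a''∈A_{s'}} Q(s',a'') for all (s,a) ∈ Φ. -/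
/-- A function on states which factors through `f` has the same expectation under `P(s,a,·)`
as its factor has under the pushforward of `P(s,a,·)` along `f`. -/
theorem sum_mul_comp_eq_sum_blockT_mul {S A S' : Type} [Fintype S] [Fintype S']
    (P : S → A → S → ℝ) (s : S) (a : A) (f : S → S') (v : S' → ℝ) :
    ∑ s' : S, P s a s' * v (f s') = ∑ t : S', blockT P s a {s' | f s' = t} * v t := by
  classical
  simp only [blockT, Set.mem_ofPred_eq, Finset.sum_mul, ite_mul, zero_mul]
  rw [Finset.sum_comm]
  simp

/-- The values at `s` of a lifted function are the values of the original function at `f s`. -/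
theorem IsMDPHom.setOf_lift_eq {S A S' A' : Type} [Fintype S]
    {Φ : Set (S × A)} {P : S → A → S → ℝ} {R : S → A → ℝ}
    {Φ' : Set (S' × A')} {P' : S' → A' → S' → ℝ} {R' : S' → A' → ℝ}
    {f : S → S'} {g : S → A → A'} (h : IsMDPHom Φ P R Φ' P' R' f g)
    (Q' : S' → A' → ℝ) (s : S) :
    {x : ℝ | ∃ a : A, (s, a) ∈ Φ ∧ x = Q' (f s) (g s a)} =
      {x : ℝ | ∃ a' : A', (f s, a') ∈ Φ' ∧ x = Q' (f s) a'} := by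
  obtain ⟨-, hmaps, hsurj, -, -⟩ := h
  ext x
  constructor
  · rintro ⟨a, ha, rfl⟩
    exact ⟨g s a, hmaps (s, a) ha, rfl⟩
  · rintro ⟨a', ha', rfl⟩
    obtain ⟨a, ha, rfl⟩ := hsurj s a' ha'
    exact ⟨a, ha, rfl⟩

/-- If `⟨f,{g_s}⟩` is an MDP homomorphism from `M` to `M'`, `γ ∈ [0,1]`,
and `Q'` satisfies the Bellman optimality equation for `M'`, then the lifted function
`Q(s,a) = Q'(f(s), g_s(a))` satisfies the Bellman optimality equation for `M`. -/
theorem stmt9 {S A S' A' : Type} [Fintype S] [Fintype A] [Fintype S'] [Fintype A']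
    (Φ : Set (S × A)) (P : S → A → S → ℝ) (R : S → A → ℝ)
    (Φ' : Set (S' × A')) (P' : S' → A' → S' → ℝ) (R' : S' → A' → ℝ)
    (hM : IsMDP Φ P) (hM' : IsMDP Φ' P')
    (f : S → S') (g : S → A → A')
    (hhom : IsMDPHom Φ P R Φ' P' R' f g)
    (γ : ℝ) (hγ0 : 0 ≤ γ) (hγ1 : γ ≤ 1)
    (Q' : S' → A' → ℝ) (hQ' : IsBellmanSolution Φ' P' R' γ Q') :
    IsBellmanSolution Φ P R γ (fun s a => Q' (f s) (g s a)) := by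
  intro p hp
  have ⟨hf, hmaps, _, hR, hP⟩ := hhom
  simp only [hhom.setOf_lift_eq Q']
  rw [hQ' _ (hmaps p hp), hR p hp, sum_mul_comp_eq_sum_blockT_mul P p.1 p.2 f
    fun t => sSup {x : ℝ | ∃ a' : A', (t, a') ∈ Φ' ∧ x = Q' t a'}]
  congr 2
  refine Finset.sum_congr rfl fun t _ => ?_
  obtain ⟨s', rfl⟩ := hf t
  rw [hP p hp s']
end

section
/- (Optimal value equivalence) Let ⟨f,{g_s}⟩ be an MDP homomorphism from a finite MDP M = ⟨S,A,Φ,P,R⟩ to a finite MDP M' = ⟨S',A',Φ',P',R'⟩, and let γ ∈ [0,1). Suppose Q : Φ → ℝ satisfies the Bellman optimality equation for M (Q(s,a) = R(s,a) + γ Σ_{s'∈S} P(s,a,s') max_{a''∈A_{s'}} Q(s',a'') for all (s,a) ∈ Φ) and Q' : Φ' → ℝ satisfies the Bellman optimality equation for M'. Then for every (s,a) ∈ Φ, Q(s,a) = Q'(f(s),g_s(a)); i.e., the optimal action-value functions satisfy Q*(s,a) = Q*(f(s),g_s(a)). -/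
/-- Over a finite action set, the state values of two action-value functions differ by at most
the bound on the difference of the action values. -/
theorem sSup_actionValue_le_add {S A : Type} [Finite A] {Φ : Set (S × A)} {s : S}
    (hs : ∃ a, (s, a) ∈ Φ) {Q₁ Q₂ : S → A → ℝ} {d : ℝ}
    (h : ∀ a, (s, a) ∈ Φ → Q₁ s a ≤ Q₂ s a + d) :
    sSup {x : ℝ | ∃ a, (s, a) ∈ Φ ∧ x = Q₁ s a} ≤
      sSup {x : ℝ | ∃ a, (s, a) ∈ Φ ∧ x = Q₂ s a} + d := by
  obtain ⟨a₀, ha₀⟩ := hs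
  refine csSup_le ⟨_, a₀, ha₀, rfl⟩ ?_
  rintro x ⟨a, ha, rfl⟩
  have hbdd : BddAbove {x : ℝ | ∃ a, (s, a) ∈ Φ ∧ x = Q₂ s a} := by
    refine ((Set.finite_range (Q₂ s)).subset ?_).bddAbove
    rintro x ⟨a, -, rfl⟩
    exact ⟨a, rfl⟩
  linarith [h a ha, le_csSup hbdd ⟨a, ha, rfl⟩]

/-- The Bellman optimality equation has at most one solution on the admissible pairs. -/
theorem IsBellmanSolution.eq {S A : Type} [Fintype S] [Fintype A] {Φ : Set (S × A)}
    {P : S → A → S → ℝ} {R : S → A → ℝ} (hM : IsMDP Φ P) {γ : ℝ} (hγ0 : 0 ≤ γ) (hγ1 : γ < 1)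
    {Q₁ Q₂ : S → A → ℝ} (h₁ : IsBellmanSolution Φ P R γ Q₁)
    (h₂ : IsBellmanSolution Φ P R γ Q₂) : ∀ p ∈ Φ, Q₁ p.1 p.2 = Q₂ p.1 p.2 := by
  intro p hp
  obtain ⟨hne, hP, hsum⟩ := hM
  obtain ⟨m, hm, hmax⟩ := Set.exists_max_image Φ (fun q => |Q₁ q.1 q.2 - Q₂ q.1 q.2|)
    (Set.toFinite Φ) ⟨p, hp⟩
  set d := |Q₁ m.1 m.2 - Q₂ m.1 m.2| with hd
  have hV : ∀ s, |sSup {x : ℝ | ∃ a, (s, a) ∈ Φ ∧ x = Q₁ s a} -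
      sSup {x : ℝ | ∃ a, (s, a) ∈ Φ ∧ x = Q₂ s a}| ≤ d := by
    intro s
    rw [abs_sub_le_iff, sub_le_iff_le_add', sub_le_iff_le_add']
    constructor
    · refine sSup_actionValue_le_add (hne s) fun a ha => ?_
      linarith [(abs_le.1 (hmax (s, a) ha)).2]
    · refine sSup_actionValue_le_add (hne s) fun a ha => ?_
      linarith [(abs_le.1 (hmax (s, a) ha)).1]
  have hcontr : d ≤ γ * d := by
    conv_lhs => rw [hd, h₁ m hm, h₂ m hm, add_sub_add_left_eq_sub, ← mul_sub,
      ← Finset.sum_sub_distrib, abs_mul, abs_of_nonneg hγ0]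
    refine mul_le_mul_of_nonneg_left ?_ hγ0
    calc _ ≤ ∑ s', P m.1 m.2 s' * d := by
          refine (Finset.abs_sum_le_sum_abs _ _).trans (Finset.sum_le_sum fun s' _ => ?_)
          rw [← mul_sub, abs_mul, abs_of_nonneg (hP m hm s').1]
          exact mul_le_mul_of_nonneg_left (hV s') (hP m hm s').1
      _ = d := by rw [← Finset.sum_mul, hsum m hm, one_mul]
  have hd0 : d ≤ 0 := by nlinarith
  exact sub_eq_zero.1 (abs_nonpos_iff.1 ((hmax p hp).trans hd0))

/-- An MDP homomorphism preserves expectations of functions of the image state. -/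
theorem IsMDPHom.sum_mul_comp {S A S' A' : Type} [Fintype S] [Fintype S']
    {Φ : Set (S × A)} {P : S → A → S → ℝ} {R : S → A → ℝ}
    {Φ' : Set (S' × A')} {P' : S' → A' → S' → ℝ} {R' : S' → A' → ℝ}
    {f : S → S'} {g : S → A → A'} (hhom : IsMDPHom Φ P R Φ' P' R' f g)
    (V : S' → ℝ) {p : S × A} (hp : p ∈ Φ) :
    ∑ s, P p.1 p.2 s * V (f s) = ∑ t, P' (f p.1) (g p.1 p.2) t * V t := by
  classical
  rw [← Finset.sum_fiberwise Finset.univ f]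
  refine Finset.sum_congr rfl fun t _ => ?_
  obtain ⟨s, rfl⟩ := hhom.1 t
  rw [← hhom.2.2.2.2 p hp s, blockT, Finset.sum_mul, Finset.sum_filter]
  refine Finset.sum_congr rfl fun s'' _ => ?_
  by_cases h : f s'' = f s <;> simp [h]

/-- Bellman solutions pull back along MDP homomorphisms. -/
theorem IsBellmanSolution.comp {S A S' A' : Type} [Fintype S] [Fintype S']
    {Φ : Set (S × A)} {P : S → A → S → ℝ} {R : S → A → ℝ}
    {Φ' : Set (S' × A')} {P' : S' → A' → S' → ℝ} {R' : S' → A' → ℝ}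
    {f : S → S'} {g : S → A → A'} {γ : ℝ} {Q' : S' → A' → ℝ}
    (hQ' : IsBellmanSolution Φ' P' R' γ Q') (hhom : IsMDPHom Φ P R Φ' P' R' f g) :
    IsBellmanSolution Φ P R γ fun s a => Q' (f s) (g s a) := by
  intro p hp
  obtain ⟨-, hmem, hsurj, hR, -⟩ := id hhom
  have hset : ∀ s, {x : ℝ | ∃ a, (s, a) ∈ Φ ∧ x = Q' (f s) (g s a)} =
      {x : ℝ | ∃ a', (f s, a') ∈ Φ' ∧ x = Q' (f s) a'} := by
    intro s
    ext x
    constructor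
    · rintro ⟨a, ha, rfl⟩
      exact ⟨g s a, hmem _ ha, rfl⟩
    · rintro ⟨a', ha', rfl⟩
      obtain ⟨a, ha, rfl⟩ := hsurj s a' ha'
      exact ⟨a, ha, rfl⟩
  simp only [hset]
  rw [hhom.sum_mul_comp (fun t => sSup {x : ℝ | ∃ a', (t, a') ∈ Φ' ∧ x = Q' t a'}) hp, hR p hp]
  exact hQ' _ (hmem p hp)

/-- **Optimal value equivalence.** If `⟨f,{g_s}⟩` is an MDP homomorphism
from `M` to `M'`, `γ ∈ [0,1)`, `Q` satisfies the Bellman optimality equation for `M` and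
`Q'` satisfies the Bellman optimality equation for `M'`, then
`Q(s,a) = Q'(f(s), g_s(a))` for every `(s,a) ∈ Φ`. -/
theorem stmt10 {S A S' A' : Type} [Fintype S] [Fintype A] [Fintype S'] [Fintype A']
    (Φ : Set (S × A)) (P : S → A → S → ℝ) (R : S → A → ℝ)
    (Φ' : Set (S' × A')) (P' : S' → A' → S' → ℝ) (R' : S' → A' → ℝ)
    (hM : IsMDP Φ P) (hM' : IsMDP Φ' P')
    (f : S → S') (g : S → A → A')
    (hhom : IsMDPHom Φ P R Φ' P' R' f g)
    (γ : ℝ) (hγ0 : 0 ≤ γ) (hγ1 : γ < 1)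
    (Q : S → A → ℝ) (hQ : IsBellmanSolution Φ P R γ Q)
    (Q' : S' → A' → ℝ) (hQ' : IsBellmanSolution Φ' P' R' γ Q') :
    ∀ p ∈ Φ, Q p.1 p.2 = Q' (f p.1) (g p.1 p.2) := by
  exact hQ.eq hM hγ0 hγ1 (hQ'.comp hhom)
end
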